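/- Under the spreadability assumptions, the cumulants are extensive: for every n ≥ 1, every π = (P_1,…,P_p) ∈ OP_n, all X_1,…,X_n ∈ A and all natural numbers N_1,…,N_p, one has ∑_{σ: σ ≤ π} μ̃(σ,π) · ( ∑ φ_{σ⋏κ(i_1,…,i_n)}(X_1,…,X_n) ) = N_1 N_2 ⋯ N_p · ∑_{σ: σ ≤ π} μ̃(σ,π) φ_σ(X_1,…,X_n), where the inner sum runs over all tuples (i_1,…,i_n) with i_k ∈ [N_{π(k)}] for every k ∈ [n]. In particular, taking N_1 = ⋯ = N_p = N gives K_π(N.X_1,…,N.X_n) = N^{|π|} K_π(X_1,…,X_n). -/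

import Mathlib

open Finset

namespace OSPpaper

/-- A *block* is a subset of `[n] = Fin n`. -/
abbrev Block (n : ℕ) := Finset (Fin n)

/-- `l` is an ordered set partition of the ground set `E ⊆ [n]`:
a finite sequence of pairwise disjoint nonempty subsets of `E` whose union is `E`. -/
def IsOSP {n : ℕ} (E : Finset (Fin n)) (l : List (Block n)) : Prop :=
  (∀ P ∈ l, P.Nonempty) ∧ l.Pairwise (fun P Q => Disjoint P Q) ∧
    (∀ P ∈ l, P ⊆ E) ∧ ∀ i ∈ E, ∃ P ∈ l, i ∈ P

/-- Union of a list of blocks. -/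
def unionList {n : ℕ} (l : List (Block n)) : Block n := l.foldr (· ∪ ·) ∅

/-- The order on ordered set partitions: `π ≤ σ` iff every block of `σ` is the union
of a contiguous run of blocks of `π` (runs taken in order). -/
def OSPle {n : ℕ} (π σ : List (Block n)) : Prop :=
  ∃ L : List (List (Block n)), L.flatten = π ∧ σ = L.map unionList

/-- The restriction `σ⌋_P`: intersect every block with `P` and delete the empty intersections. -/
def restrict {n : ℕ} (σ : List (Block n)) (P : Block n) : List (Block n) :=
  (σ.map (fun Q => Q ∩ P)).filter (fun Q => decide (Q ≠ ∅))

/-- The quasi-meet `π ⋏ σ`: the concatenation `σ⌋_{P₁} σ⌋_{P₂} ⋯ σ⌋_{P_p}`. -/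
def qmeet {n : ℕ} (π σ : List (Block n)) : List (Block n) :=
  (π.map (fun P => restrict σ P)).flatten

/-- Refinement: every block of `σ` is contained in some block of `τ`.
(As a relation on the underlying unordered partitions, this is the refinement order;
in particular `refines τ η` says `τ̄ ≤ η̄`.) -/
def refines {n : ℕ} (σ τ : List (Block n)) : Prop := ∀ P ∈ σ, ∃ Q ∈ τ, P ⊆ Q

/-- An interval partition of `[m]`, with its blocks listed in (the unique) increasing order:
an ordered set partition whose consecutive blocks are completely ordered. -/
def IsIP {m : ℕ} (l : List (Finset (Fin m))) : Prop :=
  IsOSP Finset.univ l ∧ l.Chain' (fun P Q => ∀ a ∈ P, ∀ b ∈ Q, a < b)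

/-- The (0-based) index `π(k)` of the block of `π` containing `k`. -/
def blockIdx {n : ℕ} (π : List (Block n)) (k : Fin n) : ℕ :=
  π.findIdx (fun P => decide (k ∈ P))

/-- The ordered kernel `κ(i₁,…,iₙ)` of a tuple: the nonempty level sets of the tuple,
listed in increasing order of the value. -/
def kernel {n : ℕ} (i : Fin n → ℕ) : List (Block n) :=
  ((Finset.image i Finset.univ).sort (· ≤ ·)).map
    (fun v => Finset.univ.filter (fun k => i k = v))

/-- `[σ:π] = ∏_{P ∈ π} #(σ⌋_P)`. -/
def colonNum {n : ℕ} (σ π : List (Block n)) : ℕ :=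
  (π.map (fun P => (restrict σ P).length)).prod

/-- `[σ:π]! = ∏_{P ∈ π} #(σ⌋_P)!`. -/
def colonFac {n : ℕ} (σ π : List (Block n)) : ℕ :=
  (π.map (fun P => Nat.factorial (restrict σ P).length)).prod

/-- For `τ̄ ≤ η̄` the sequence `(m_1,…,m_s)`: `m_i` is the (0-based) index of the block of `η`
containing the `i`-th block of `τ`. -/
def mseq {n : ℕ} (τ η : List (Block n)) : List ℕ :=
  τ.map (fun T => η.findIdx (fun E => decide (T ⊆ E)))

/-- number of ascents of a sequence -/
def ascL (l : List ℕ) : ℕ := ((l.zip l.tail).filter (fun p => decide (p.1 < p.2))).length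
/-- number of descents of a sequence -/
def desL (l : List ℕ) : ℕ := ((l.zip l.tail).filter (fun p => decide (p.2 < p.1))).length
/-- number of plateaux of a sequence -/
def platL (l : List ℕ) : ℕ := ((l.zip l.tail).filter (fun p => decide (p.1 = p.2))).length

/-- `asc_η(τ)` -/
def ascN {n : ℕ} (τ η : List (Block n)) : ℕ := ascL (mseq τ η)
/-- `des_η(τ)` -/
def desN {n : ℕ} (τ η : List (Block n)) : ℕ := desL (mseq τ η)
/-- `plat_η(τ)` -/
def platN {n : ℕ} (τ η : List (Block n)) : ℕ := platL (mseq τ η)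

/-- lengths of the maximal ascending runs of a sequence -/
def ascRunLengths (l : List ℕ) : List ℕ :=
  (l.splitBy (fun a b => decide (a < b))).map List.length
/-- lengths of the maximal level (constant) runs of a sequence -/
def levelRunLengths (l : List ℕ) : List ℕ :=
  (l.splitBy (fun a b => decide (a = b))).map List.length

/-- `μ̃(σ,π) = (−1)^{|σ|−|π|} / [σ:π]` (real-valued). -/
noncomputable def muR {n : ℕ} (σ π : List (Block n)) : ℝ :=
  (-1 : ℝ) ^ (σ.length - π.length) / (colonNum σ π : ℝ)

/-- `ζ̃(σ,π) = 1 / [σ:π]!` (real-valued). -/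
noncomputable def zetaR {n : ℕ} (σ π : List (Block n)) : ℝ :=
  1 / (colonFac σ π : ℝ)

/-- The Weisner coefficient `w(τ,η) = ∑_{σ ⋏ η = τ} μ̃(σ, 1̂ₙ)`. -/
noncomputable def wcoef {n : ℕ} (τ η : List (Block n)) : ℝ :=
  ∑ᶠ σ ∈ {σ : List (Block n) | IsOSP Finset.univ σ ∧ qmeet σ η = τ},
    muR σ [(Finset.univ : Block n)]

/-- The Goldberg coefficient `g(τ,η) = ∑_{σ ≥ τ} ζ̃(τ,σ) w(σ,η)`. -/
noncomputable def gcoef {n : ℕ} (τ η : List (Block n)) : ℝ :=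
  ∑ᶠ σ ∈ {σ : List (Block n) | IsOSP Finset.univ σ ∧ OSPle τ σ}, zetaR τ σ * wcoef σ η


/-- `μ̃(σ,π) = (−1)^{|σ|−|π|} / [σ:π]` (complex-valued). -/
noncomputable def muC {n : ℕ} (σ π : List (Block n)) : ℂ :=
  (-1 : ℂ) ^ (σ.length - π.length) / (colonNum σ π : ℂ)

/-- The partitioned expectation `φ_τ(X₁,…,Xₙ) = φ̃(ι^{(τ(1))}(X₁) ⋯ ι^{(τ(n))}(Xₙ))`. -/
noncomputable def phiPart {A U B : Type*} [Ring A] [Algebra ℂ A] [Ring U] [Algebra ℂ U]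
    [AddCommGroup B] [Module ℂ B] (φ : U →ₗ[ℂ] B) (ι : ℕ → (A →ₙₐ[ℂ] U))
    {n : ℕ} (τ : List (Block n)) (X : Fin n → A) : B :=
  φ ((List.ofFn (fun k => ι (blockIdx τ k) (X k))).prod)

section

/-- The blocks of `l` are the level sets of `u`, listed in increasing order of the value of `u`. -/
structure Ranks {n : ℕ} {α : Type*} [LinearOrder α] (l : List (Block n)) (u : Fin n → α) :
    Prop where
  nonempty : ∀ P ∈ l, P.Nonempty
  lt : l.Pairwise (fun P Q => ∀ a ∈ P, ∀ b ∈ Q, u a < u b)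
  const : ∀ P ∈ l, ∀ a ∈ P, ∀ b ∈ P, u a = u b
  cover : ∀ k, ∃ P ∈ l, k ∈ P

namespace Ranks

variable {n : ℕ} {α β : Type*} [LinearOrder α] [LinearOrder β] {l l' : List (Block n)}
  {u : Fin n → α} {v : Fin n → β}

lemma isOSP (h : Ranks l u) : IsOSP Finset.univ l := by
  refine ⟨h.nonempty, h.lt.imp ?_, fun P _ => Finset.subset_univ P, fun i _ => h.cover i⟩
  intro P Q hPQ
  exact Finset.disjoint_left.2 fun a ha ha' => lt_irrefl _ (hPQ a ha a ha')

/-- A list of blocks orders any two elements lying in distinct blocks. -/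
lemma exists_trichotomy (hcov : ∀ k, ∃ P ∈ l, k ∈ P) {r : Fin n → Fin n → Prop}
    (hr : l.Pairwise (fun P Q => ∀ a ∈ P, ∀ b ∈ Q, r a b)) (a b : Fin n) :
    (∃ P ∈ l, a ∈ P ∧ b ∈ P) ∨ r a b ∨ r b a := by
  obtain ⟨P, hP, ha⟩ := hcov a
  obtain ⟨Q, hQ, hb⟩ := hcov b
  by_cases hPQ : P = Q
  · exact Or.inl ⟨P, hP, ha, hPQ ▸ hb⟩
  · right
    have hsymm : Std.Symm (fun P Q : Block n =>
        (∀ a ∈ P, ∀ b ∈ Q, r a b) ∨ ∀ a ∈ Q, ∀ b ∈ P, r a b) :=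
      ⟨fun _ _ h => h.symm⟩
    have := (hr.imp (S := fun P Q : Block n =>
        (∀ a ∈ P, ∀ b ∈ Q, r a b) ∨ ∀ a ∈ Q, ∀ b ∈ P, r a b) Or.inl).forall hP hQ hPQ
    exact this.imp (fun h => h a ha b hb) (fun h => h b hb a ha)

lemma lt_of_lt (h : Ranks l u) {r : Fin n → Fin n → Prop}
    (hr : l.Pairwise (fun P Q => ∀ a ∈ P, ∀ b ∈ Q, r a b)) {a b : Fin n} (hab : u a < u b) :
    r a b := by
  have := exists_trichotomy (r := fun a b => u a < u b ∧ r a b) h.cover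
    ((h.lt.and hr).imp fun h a ha b hb => ⟨h.1 a ha b hb, h.2 a ha b hb⟩) a b
  rcases this with ⟨P, hP, ha, hb⟩ | h' | h'
  · exact absurd (h.const P hP a ha b hb) hab.ne
  · exact h'.2
  · exact absurd h'.1 hab.not_gt

lemma lt_iff_lt (h : Ranks l u) (h' : Ranks l v) (a b : Fin n) : u a < u b ↔ v a < v b :=
  ⟨h.lt_of_lt h'.lt, h'.lt_of_lt h.lt⟩

lemma congr (h : Ranks l u) (huv : ∀ a b, u a < u b ↔ v a < v b) : Ranks l v where
  nonempty := h.nonempty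
  lt := h.lt.imp fun h a ha b hb => (huv a b).1 (h a ha b hb)
  const P hP a ha b hb := by
    have := h.const P hP a ha b hb
    apply le_antisymm <;> rw [← not_lt, ← huv] <;> exact (by simp [this])
  cover := h.cover

lemma mem_iff (h : Ranks l u) (Q : Block n) :
    Q ∈ l ↔ ∃ a, Q = Finset.univ.filter (fun k => u k = u a) := by
  have key : ∀ P ∈ l, ∀ a ∈ P, P = Finset.univ.filter (fun k => u k = u a) := by
    intro P hP a ha
    ext k
    simp only [Finset.mem_filter, Finset.mem_univ, true_and]
    refine ⟨fun hk => h.const P hP k hk a ha, fun hk => ?_⟩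
    rcases exists_trichotomy (r := fun a b => u a < u b) h.cover h.lt k a with
      ⟨R, hR, hkR, haR⟩ | h' | h'
    · by_cases hPR : P = R
      · exact hPR ▸ hkR
      · have : Disjoint P R :=
          h.isOSP.2.1.forall hP hR hPR
        exact absurd haR (Finset.disjoint_left.1 this ha)
    · exact absurd hk h'.ne
    · exact absurd hk h'.ne'
  constructor
  · intro hQ
    obtain ⟨a, ha⟩ := h.nonempty Q hQ
    exact ⟨a, key Q hQ a ha⟩
  · rintro ⟨a, rfl⟩
    obtain ⟨P, hP, ha⟩ := h.cover a
    exact key P hP a ha ▸ hP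

lemma nodup (h : Ranks l u) : l.Nodup := by
  refine List.Pairwise.imp_of_mem ?_ h.lt
  rintro P Q hP _ hPQ rfl
  obtain ⟨a, ha⟩ := h.nonempty P hP
  exact lt_irrefl _ (hPQ a ha a ha)

lemma unique (h : Ranks l u) (h' : Ranks l' u) : l = l' := by
  have hperm : l.Perm l' :=
    (List.perm_ext_iff_of_nodup h.nodup h'.nodup).2 fun Q => by rw [h.mem_iff, h'.mem_iff]
  refine hperm.eq_of_pairwise ?_ h.lt h'.lt
  intro P Q hP hQ hPQ hQP
  obtain ⟨a, ha⟩ := h.nonempty P hP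
  obtain ⟨b, hb⟩ := h'.nonempty Q hQ
  exact absurd (hPQ a ha b hb) (hQP b hb a ha).not_gt

end Ranks

variable {n : ℕ}

lemma mem_getElem_iff_blockIdx_eq {l : List (Block n)} (hl : IsOSP Finset.univ l) {i : ℕ}
    (hi : i < l.length) (k : Fin n) : k ∈ l[i] ↔ blockIdx l k = i := by
  have hd := List.pairwise_iff_getElem.1 hl.2.1
  rw [blockIdx, List.findIdx_eq hi]
  simp only [decide_eq_true_eq, decide_eq_false_iff_not]
  exact ⟨fun hk => ⟨hk, fun j hj hkj =>
    Finset.disjoint_left.1 (hd j i (hj.trans hi) hi hj) hkj hk⟩, fun h => h.1⟩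

lemma blockIdx_lt_length {l : List (Block n)} (hl : IsOSP Finset.univ l) (k : Fin n) :
    blockIdx l k < l.length := by
  obtain ⟨P, hP, hk⟩ := hl.2.2.2 k (Finset.mem_univ k)
  exact List.findIdx_lt_length_of_exists ⟨P, hP, by simpa using hk⟩

lemma IsOSP.ranks_blockIdx {l : List (Block n)} (hl : IsOSP Finset.univ l) :
    Ranks l (blockIdx l) where
  nonempty := hl.1
  lt := by
    refine List.pairwise_iff_getElem.2 fun i j hi hj hij a ha b hb => ?_
    rw [(mem_getElem_iff_blockIdx_eq hl hi a).1 ha, (mem_getElem_iff_blockIdx_eq hl hj b).1 hb]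
    exact hij
  const := by
    intro P hP a ha b hb
    obtain ⟨i, hi, rfl⟩ := List.getElem_of_mem hP
    rw [(mem_getElem_iff_blockIdx_eq hl hi a).1 ha, (mem_getElem_iff_blockIdx_eq hl hi b).1 hb]
  cover k := hl.2.2.2 k (Finset.mem_univ k)

lemma ranks_kernel (i : Fin n → ℕ) : Ranks (kernel i) i where
  nonempty := by
    intro P hP
    simp only [kernel, List.mem_map, Finset.mem_sort, Finset.mem_image, Finset.mem_univ,
      true_and] at hP
    obtain ⟨_, ⟨a, rfl⟩, rfl⟩ := hP
    exact ⟨a, by simp⟩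
  lt := by
    rw [kernel, List.pairwise_map]
    refine (Finset.sortedLT_sort (Finset.image i Finset.univ)).pairwise.imp ?_
    intro x y hxy a ha b hb
    simp only [Finset.mem_filter, Finset.mem_univ, true_and] at ha hb
    rwa [ha, hb]
  const := by
    intro P hP a ha b hb
    simp only [kernel, List.mem_map] at hP
    obtain ⟨v, -, rfl⟩ := hP
    simp only [Finset.mem_filter, Finset.mem_univ, true_and] at ha hb
    rw [ha, hb]
  cover k := ⟨Finset.univ.filter (fun j => i j = i k), by simp [kernel], by simp⟩

lemma mem_restrict {σ : List (Block n)} {P R : Block n} :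
    R ∈ restrict σ P ↔ (∃ Q ∈ σ, Q ∩ P = R) ∧ R.Nonempty := by
  simp [restrict, Finset.nonempty_iff_ne_empty]

lemma Ranks.qmeet {α β : Type*} [LinearOrder α] [LinearOrder β] {σ τ : List (Block n)}
    {u : Fin n → α} {v : Fin n → β} (hσ : Ranks σ u) (hτ : Ranks τ v) :
    Ranks (qmeet σ τ) (fun k => toLex (u k, v k)) where
  nonempty := by
    intro R hR
    simp only [OSPpaper.qmeet, List.mem_flatten, List.mem_map] at hR
    obtain ⟨_, ⟨P, hP, rfl⟩, hR⟩ := hR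
    exact (mem_restrict.1 hR).2
  lt := by
    rw [OSPpaper.qmeet, List.pairwise_flatten]
    constructor
    · intro L hL
      obtain ⟨P, hP, rfl⟩ := List.mem_map.1 hL
      refine List.Pairwise.filter _ (List.pairwise_map.2 (hτ.lt.imp ?_))
      intro Q Q' hQ a ha b hb
      rw [Finset.mem_inter] at ha hb
      exact Prod.Lex.toLex_lt_toLex.2
        (Or.inr ⟨hσ.const P hP a ha.2 b hb.2, hQ a ha.1 b hb.1⟩)
    · refine List.pairwise_map.2 (hσ.lt.imp ?_)
      intro P P' hP R hR R' hR' a ha b hb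
      obtain ⟨⟨Q, -, rfl⟩, -⟩ := mem_restrict.1 hR
      obtain ⟨⟨Q', -, rfl⟩, -⟩ := mem_restrict.1 hR'
      exact Prod.Lex.toLex_lt_toLex.2
        (Or.inl (hP a (Finset.mem_inter.1 ha).2 b (Finset.mem_inter.1 hb).2))
  const := by
    intro R hR a ha b hb
    simp only [OSPpaper.qmeet, List.mem_flatten, List.mem_map] at hR
    obtain ⟨_, ⟨P, hP, rfl⟩, hR⟩ := hR
    obtain ⟨⟨Q, hQ, rfl⟩, -⟩ := mem_restrict.1 hR
    rw [Finset.mem_inter] at ha hb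
    rw [hσ.const P hP a ha.2 b hb.2, hτ.const Q hQ a ha.1 b hb.1]
  cover k := by
    obtain ⟨P, hP, hkP⟩ := hσ.cover k
    obtain ⟨Q, hQ, hkQ⟩ := hτ.cover k
    have hk : k ∈ Q ∩ P := Finset.mem_inter.2 ⟨hkQ, hkP⟩
    refine ⟨Q ∩ P, ?_, hk⟩
    simp only [OSPpaper.qmeet, List.mem_flatten, List.mem_map]
    exact ⟨_, ⟨P, hP, rfl⟩, mem_restrict.2 ⟨⟨Q, hQ, rfl⟩, k, hk⟩⟩

lemma mem_unionList {l : List (Block n)} {k : Fin n} : k ∈ unionList l ↔ ∃ P ∈ l, k ∈ P := by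
  induction l with
  | nil => simp [unionList]
  | cons Q t ih =>
    simp only [unionList, List.foldr_cons, Finset.mem_union, List.mem_cons,
      exists_eq_or_imp] at ih ⊢
    rw [ih]

lemma OSPle_qmeet {α : Type*} [LinearOrder α] {π τ : List (Block n)} {v : Fin n → α}
    (hτ : Ranks τ v) : OSPle (qmeet π τ) π := by
  refine ⟨π.map (restrict τ), rfl, ?_⟩
  rw [List.map_map]
  refine (List.map_id'' (fun P => ?_) π).symm
  ext k
  simp only [Function.comp_apply, mem_unionList, mem_restrict]
  constructor
  · rintro ⟨_, ⟨⟨Q, -, rfl⟩, -⟩, hk⟩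
    exact (Finset.mem_inter.1 hk).2
  · intro hk
    obtain ⟨Q, hQ, hkQ⟩ := hτ.cover k
    have hk' : k ∈ Q ∩ P := Finset.mem_inter.2 ⟨hkQ, hk⟩
    exact ⟨_, ⟨⟨Q, hQ, rfl⟩, k, hk'⟩, hk'⟩

lemma OSPle.lt_of_lt {α β : Type*} [LinearOrder α] [LinearOrder β] {σ π : List (Block n)}
    {u : Fin n → α} {v : Fin n → β} (h : OSPle σ π) (hσ : Ranks σ u) (hπ : Ranks π v)
    {a b : Fin n} (hab : v a < v b) : u a < u b := by
  obtain ⟨L, rfl, rfl⟩ := h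
  refine hπ.lt_of_lt (r := fun a b => u a < u b) ?_ hab
  refine List.pairwise_map.2 ((List.pairwise_flatten.1 hσ.lt).2.imp ?_)
  intro l₁ l₂ h a ha b hb
  obtain ⟨P, hP, haP⟩ := mem_unionList.1 ha
  obtain ⟨Q, hQ, hbQ⟩ := mem_unionList.1 hb
  exact h P hP Q hQ a haP b hbQ

lemma qmeet_eq_iff {α β γ : Type*} [LinearOrder α] [LinearOrder β] [LinearOrder γ]
    {σ π τ : List (Block n)} {u : Fin n → α} {v : Fin n → β} {w : Fin n → γ}
    (h : OSPle σ π) (hσ : Ranks σ u) (hπ : Ranks π v) (hτ : Ranks τ w) :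
    qmeet π τ = σ ↔ ∀ a b, v a = v b → (w a < w b ↔ u a < u b) := by
  have hq := hπ.qmeet hτ
  constructor
  · rintro rfl a b hab
    rw [← hq.lt_iff_lt hσ a b, Prod.Lex.toLex_lt_toLex]
    simp [hab]
  · intro H
    refine (hq.congr fun a b => ?_).unique hσ
    rw [Prod.Lex.toLex_lt_toLex]
    rcases lt_trichotomy (v a) (v b) with hab | hab | hab
    · simp [hab, h.lt_of_lt hσ hπ hab]
    · simp [hab, H a b hab]
    · simp [hab.not_gt, hab.ne', (h.lt_of_lt hσ hπ hab).le]

lemma qmeet_eq_self {σ π : List (Block n)} (h : OSPle σ π) (hσ : IsOSP Finset.univ σ)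
    (hπ : IsOSP Finset.univ π) : qmeet π σ = σ :=
  (qmeet_eq_iff h hσ.ranks_blockIdx hπ.ranks_blockIdx hσ.ranks_blockIdx).2 fun _ _ _ => Iff.rfl

lemma length_restrict {α : Type*} [LinearOrder α] {σ : List (Block n)} {u : Fin n → α}
    (hσ : Ranks σ u) (P : Block n) : (restrict σ P).length = (P.image u).card := by
  have hq : (restrict σ P).Pairwise (fun Q R => ∀ a ∈ Q, ∀ b ∈ R, u a < u b) := by
    refine List.Pairwise.filter _ (List.pairwise_map.2 (hσ.lt.imp ?_))
    intro Q Q' hQ a ha b hb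
    exact hQ a (Finset.mem_inter.1 ha).1 b (Finset.mem_inter.1 hb).1
  have hnd : (restrict σ P).Nodup := by
    refine List.Pairwise.imp_of_mem ?_ hq
    rintro Q R hQ _ hQR rfl
    obtain ⟨a, ha⟩ := (mem_restrict.1 hQ).2
    exact lt_irrefl _ (hQR a ha a ha)
  have himg : ∀ Q ∈ restrict σ P, ∀ a ∈ Q, Q.image u = {u a} := by
    intro Q hQ a ha
    obtain ⟨⟨R, hR, rfl⟩, -⟩ := mem_restrict.1 hQ
    refine Finset.eq_singleton_iff_unique_mem.2 ⟨Finset.mem_image_of_mem u ha, ?_⟩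
    intro x hx
    obtain ⟨b, hb, rfl⟩ := Finset.mem_image.1 hx
    exact hσ.const R hR b (Finset.mem_inter.1 hb).1 a (Finset.mem_inter.1 ha).1
  have hP : P = (restrict σ P).toFinset.biUnion id := by
    ext k
    simp only [Finset.mem_biUnion, List.mem_toFinset, id, mem_restrict]
    constructor
    · intro hk
      obtain ⟨Q, hQ, hkQ⟩ := hσ.cover k
      have hk' : k ∈ Q ∩ P := Finset.mem_inter.2 ⟨hkQ, hk⟩
      exact ⟨_, ⟨⟨Q, hQ, rfl⟩, k, hk'⟩, hk'⟩
    · rintro ⟨_, ⟨⟨Q, -, rfl⟩, -⟩, hk⟩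
      exact (Finset.mem_inter.1 hk).2
  rw [← List.toFinset_card_of_nodup hnd]
  conv_rhs => rw [hP, Finset.biUnion_image]
  rw [Finset.card_biUnion, Finset.card_eq_sum_ones]
  · refine Finset.sum_congr rfl fun Q hQ => ?_
    rw [List.mem_toFinset] at hQ
    obtain ⟨a, ha⟩ := (mem_restrict.1 hQ).2
    rw [id, himg Q hQ a ha, Finset.card_singleton]
  · intro Q hQ R hR hQR
    rw [Finset.mem_coe, List.mem_toFinset] at hQ hR
    have hsymm : Std.Symm (fun Q R : Block n => Disjoint (Q.image u) (R.image u)) :=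
      ⟨fun _ _ h => h.symm⟩
    refine (hq.imp (S := fun Q R : Block n => Disjoint (Q.image u) (R.image u)) ?_).forall
      hQ hR hQR
    intro Q R h
    rw [Finset.disjoint_left]
    intro x hx hx'
    obtain ⟨a, ha, rfl⟩ := Finset.mem_image.1 hx
    obtain ⟨b, hb, hab⟩ := Finset.mem_image.1 hx'
    exact (h a ha b hb).ne' hab

lemma card_image_eq_of_eq_iff {ι α β : Type*} [DecidableEq α] [DecidableEq β] {C : Finset ι}
    {s : ι → α} {b : ι → β} (h : ∀ k ∈ C, ∀ l ∈ C, s k = s l ↔ b k = b l) :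
    (C.image s).card = (C.image b).card := by
  classical
  have h₁ : C.image s = (C.image fun k => (s k, b k)).image Prod.fst := by
    rw [Finset.image_image]; rfl
  have h₂ : C.image b = (C.image fun k => (s k, b k)).image Prod.snd := by
    rw [Finset.image_image]; rfl
  have hfst : Set.InjOn Prod.fst ((C.image fun k => (s k, b k)) : Set (α × β)) := by
    intro x hx y hy hxy
    simp only [Finset.coe_image, Set.mem_image, Finset.mem_coe] at hx hy
    obtain ⟨k, hk, rfl⟩ := hx
    obtain ⟨l, hl, rfl⟩ := hy
    exact Prod.ext hxy ((h k hk l hl).1 hxy)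
  have hsnd : Set.InjOn Prod.snd ((C.image fun k => (s k, b k)) : Set (α × β)) := by
    intro x hx y hy hxy
    simp only [Finset.coe_image, Set.mem_image, Finset.mem_coe] at hx hy
    obtain ⟨k, hk, rfl⟩ := hx
    obtain ⟨l, hl, rfl⟩ := hy
    exact Prod.ext ((h k hk l hl).2 hxy) hxy
  rw [h₁, h₂, Finset.card_image_of_injOn hfst, Finset.card_image_of_injOn hsnd]

lemma exists_strictMonoOn_image_eq {S T : Finset ℕ} (h : S.card = T.card) :
    ∃ g : ℕ → ℕ, (∀ x ∈ T, ∀ y ∈ T, x < y → g x < g y) ∧ T.image g = S := by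
  let e : T ≃o S := (T.orderIsoOfFin rfl).symm.trans (S.orderIsoOfFin h)
  have he : ∀ x (hx : x ∈ T), (if hx : x ∈ T then (e ⟨x, hx⟩ : ℕ) else 0) = e ⟨x, hx⟩ :=
    fun x hx => dif_pos hx
  refine ⟨fun x => if hx : x ∈ T then (e ⟨x, hx⟩ : ℕ) else 0, ?_, ?_⟩
  · intro x hx y hy hxy
    simp only [he x hx, he y hy]
    exact e.strictMono hxy
  · ext z
    simp only [Finset.mem_image]
    constructor
    · rintro ⟨x, hx, rfl⟩
      rw [he x hx]
      exact (e ⟨x, hx⟩).2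
    · intro hz
      exact ⟨e.symm ⟨z, hz⟩, (e.symm ⟨z, hz⟩).2, by rw [he _ (e.symm ⟨z, hz⟩).2]; simp⟩

/-- The number of tuples `s` with prescribed order type `b` on each fibre of `c` and
with `s k ∈ [M (c k)]`. -/
lemma card_orderType {ι κ : Type*} [Fintype ι] [DecidableEq ι] [Fintype κ] [DecidableEq κ]
    (c : ι → κ) (M : κ → ℕ) (b : ι → ℕ)
    [DecidablePred fun s : ι → ℕ => ∀ k l, c k = c l → (s k < s l ↔ b k < b l)] :
    ((Fintype.piFinset fun k => Finset.Icc 1 (M (c k))).filter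
      fun s => ∀ k l, c k = c l → (s k < s l ↔ b k < b l)).card =
    ∏ j, (M j).choose ((Finset.univ.filter (c · = j)).image b).card := by
  have heq : ∀ {s : ι → ℕ}, (∀ k l, c k = c l → (s k < s l ↔ b k < b l)) →
      ∀ k l, c k = c l → (s k = s l ↔ b k = b l) := by
    intro s hs k l hkl
    have h₁ := hs k l hkl
    have h₂ := hs l k hkl.symm
    omega
  have hcard : ∏ j, (M j).choose ((Finset.univ.filter (c · = j)).image b).card =
      (Fintype.piFinset fun j => Finset.powersetCard
        ((Finset.univ.filter (c · = j)).image b).card (Finset.Icc 1 (M j))).card := by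
    rw [Fintype.card_piFinset]
    exact Finset.prod_congr rfl fun j _ => by simp [Finset.card_powersetCard]
  rw [hcard]
  refine Finset.card_bij (fun s _ j => (Finset.univ.filter (c · = j)).image s) ?_ ?_ ?_
  · intro s hs
    rw [Finset.mem_filter, Fintype.mem_piFinset] at hs
    rw [Fintype.mem_piFinset]
    intro j
    rw [Finset.mem_powersetCard]
    constructor
    · intro x hx
      obtain ⟨k, hk, rfl⟩ := Finset.mem_image.1 hx
      exact (Finset.mem_filter.1 hk).2 ▸ hs.1 k
    · refine card_image_eq_of_eq_iff fun k hk l hl => heq hs.2 k l ?_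
      rw [(Finset.mem_filter.1 hk).2, (Finset.mem_filter.1 hl).2]
  · intro s hs s' hs' hss
    rw [Finset.mem_filter] at hs hs'
    have hrank : ∀ {s : ι → ℕ}, (∀ k l, c k = c l → (s k < s l ↔ b k < b l)) → ∀ k,
        (((Finset.univ.filter (c · = c k)).image s).filter (· < s k)).card =
        ((Finset.univ.filter (fun l => c l = c k ∧ b l < b k)).image b).card := by
      intro s hs k
      rw [Finset.filter_image, Finset.filter_filter]
      have : (Finset.univ.filter fun l => c l = c k ∧ s l < s k) =
          Finset.univ.filter (fun l => c l = c k ∧ b l < b k) :=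
        Finset.filter_congr fun l _ => and_congr_right fun hl => hs l k hl
      rw [this]
      refine card_image_eq_of_eq_iff fun l hl l' hl' => heq hs l l' ?_
      rw [(Finset.mem_filter.1 hl).2.1, (Finset.mem_filter.1 hl').2.1]
    funext k
    have hk := congrFun hss (c k)
    have h₁ := hrank hs.2 k
    have h₂ := hrank hs'.2 k
    rw [hk] at h₁
    have aux : ∀ (S : Finset ℕ) (x y : ℕ), x ∈ S → x < y →
        (S.filter (· < x)).card < (S.filter (· < y)).card := by
      intro S x y hx hxy
      refine Finset.card_lt_card (Finset.ssubset_iff_of_subset ?_ |>.2 ⟨x, by simp [hx, hxy]⟩)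
      exact Finset.monotone_filter_right S fun z _ hz => lt_trans hz hxy
    have hmem : s k ∈ (Finset.univ.filter (c · = c k)).image s' := by
      rw [← hk]; exact Finset.mem_image_of_mem s (by simp)
    have hmem' : s' k ∈ (Finset.univ.filter (c · = c k)).image s' :=
      Finset.mem_image_of_mem s' (by simp)
    rcases lt_trichotomy (s k) (s' k) with h | h | h
    · have := aux _ _ _ hmem h; omega
    · exact h
    · have := aux _ _ _ hmem' h; omega
  · intro S hS
    rw [Fintype.mem_piFinset] at hS
    simp only [Finset.mem_powersetCard] at hS
    choose g hg hgS using fun j => exists_strictMonoOn_image_eq (hS j).2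
    have hb : ∀ k, b k ∈ (Finset.univ.filter (c · = c k)).image b := fun k =>
      Finset.mem_image_of_mem b (by simp)
    refine ⟨fun k => g (c k) (b k), ?_, ?_⟩
    · rw [Finset.mem_filter, Fintype.mem_piFinset]
      refine ⟨fun k => (hS (c k)).1 ?_, fun k l hkl => ?_⟩
      · rw [← hgS (c k)]
        exact Finset.mem_image_of_mem _ (hb k)
      · have hk := hb k
        rw [hkl] at hk
        simp only [hkl]
        refine ⟨fun h => ?_, hg (c l) _ hk _ (hb l)⟩
        by_contra hlt
        rcases (not_lt.1 hlt).lt_or_eq with h' | h'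
        · exact absurd h (hg (c l) _ (hb l) _ hk h').not_gt
        · rw [h'] at h
          exact lt_irrefl _ h
    · funext j
      rw [← hgS j, Finset.image_image]
      refine Finset.image_congr fun k hk => ?_
      rw [Finset.mem_coe, Finset.mem_filter] at hk
      simp [hk.2]

open Polynomial in
/-- Evaluating at `0, …, n` suffices to read off the linear coefficient of a polynomial of
degree at most `n`. -/
lemma exists_weights_coeff_one (n : ℕ) :
    ∃ w : ℕ → ℂ, ∀ p : ℂ[X], p.natDegree ≤ n →
      ∑ k ∈ Finset.range (n + 1), w k * p.eval (k : ℂ) = p.coeff 1 := by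
  refine ⟨fun k => (Lagrange.basis (Finset.range (n + 1)) (fun k : ℕ => (k : ℂ)) k).coeff 1,
    fun p hp => ?_⟩
  have hdeg : p.degree < (Finset.range (n + 1)).card := by
    rw [Finset.card_range]
    exact lt_of_le_of_lt p.degree_le_natDegree (by exact_mod_cast Nat.lt_succ_of_le hp)
  have h := Lagrange.eq_interpolate (s := Finset.range (n + 1)) (v := fun k : ℕ => (k : ℂ))
    (fun x _ y _ hxy => Nat.cast_injective hxy) hdeg
  conv_rhs => rw [h, Lagrange.interpolate_apply, finsetSum_coeff]
  simp only [coeff_C_mul]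
  exact Finset.sum_congr rfl fun k _ => mul_comm _ _

open Polynomial in
lemma descPochhammer_eval_neg_one (m : ℕ) :
    (descPochhammer ℂ m).eval (-1) = (-1) ^ m * (m.factorial : ℂ) := by
  induction m with
  | zero => simp
  | succ m ih => rw [descPochhammer_succ_eval, ih, Nat.factorial_succ]; push_cast; ring

open Polynomial in
lemma exists_weights_choose (n : ℕ) :
    ∃ w : ℕ → ℂ, ∀ N m : ℕ, 1 ≤ m → m ≤ n →
      ∑ k ∈ Finset.range (n + 1), w k * ((k * N).choose m : ℂ) =
        N * ((-1) ^ (m - 1) / (m : ℂ)) := by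
  obtain ⟨w, hw⟩ := exists_weights_coeff_one n
  refine ⟨w, fun N m hm hmn => ?_⟩
  have hfac : (m.factorial : ℂ) ≠ 0 := by exact_mod_cast m.factorial_ne_zero
  have hdeg : (C (1 / (m.factorial : ℂ)) * (descPochhammer ℂ m).comp (C (N : ℂ) * X)).natDegree
      ≤ n := by
    refine (natDegree_C_mul_le _ _).trans (natDegree_comp_le.trans ?_)
    rw [descPochhammer_natDegree]
    exact (Nat.mul_le_mul_left m ((natDegree_C_mul_le _ _).trans natDegree_X_le)).trans (by omega)
  have h := hw _ hdeg
  have heval : ∀ k : ℕ, (C (1 / (m.factorial : ℂ)) *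
      (descPochhammer ℂ m).comp (C (N : ℂ) * X)).eval (k : ℂ) = ((k * N).choose m : ℂ) := by
    intro k
    rw [eval_C_mul, eval_comp, eval_C_mul, eval_X,
      show (N : ℂ) * k = ((k * N : ℕ) : ℂ) by push_cast; ring,
      descPochhammer_eval_eq_descFactorial, Nat.descFactorial_eq_factorial_mul_choose]
    push_cast
    field_simp
  simp only [heval] at h
  rw [h]
  obtain ⟨m, rfl⟩ : ∃ r, m = r + 1 := ⟨m - 1, by omega⟩
  have hm0 : ((m : ℂ) + 1) ≠ 0 := by exact_mod_cast m.succ_ne_zero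
  have hmf : (m.factorial : ℂ) ≠ 0 := by exact_mod_cast m.factorial_ne_zero
  rw [coeff_C_mul, comp_C_mul_X_coeff, descPochhammer_succ_left, coeff_X_mul,
    coeff_zero_eq_eval_zero, eval_comp]
  simp only [eval_sub, eval_X, eval_one, zero_sub, descPochhammer_eval_neg_one,
    Nat.factorial_succ, Nat.add_sub_cancel]
  push_cast
  field_simp

lemma finite_isOSP (n : ℕ) : {σ : List (Block n) | IsOSP Finset.univ σ}.Finite := by
  have : Finite {σ : List (Block n) | σ.Nodup} :=
    inferInstanceAs (Finite {σ : List (Block n) // σ.Nodup})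
  refine (Set.toFinite {σ : List (Block n) | σ.Nodup}).subset fun σ hσ => ?_
  exact (IsOSP.ranks_blockIdx hσ).nodup

lemma finite_OSPle (π : List (Block n)) :
    {σ : List (Block n) | IsOSP Finset.univ σ ∧ OSPle σ π}.Finite :=
  (finite_isOSP n).subset fun _ h => h.1

section Extensivity

variable {B : Type*} [AddCommGroup B] {π : List (Block n)}

/-- The index in `Fin π.length` of the block of `π` containing a given element. -/
def blockFin (hπ : IsOSP Finset.univ π) (k : Fin n) : Fin π.length :=
  ⟨blockIdx π k, blockIdx_lt_length hπ k⟩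

lemma filter_blockFin (hπ : IsOSP Finset.univ π) (j : Fin π.length) :
    Finset.univ.filter (blockFin hπ · = j) = π[j] := by
  ext k
  simp only [Finset.mem_filter, Finset.mem_univ, true_and, blockFin, Fin.ext_iff]
  exact (mem_getElem_iff_blockIdx_eq hπ j.2 k).symm

/-- Sums over tuples, grouped by the ordered set partition they induce below `π`. -/
lemma sum_qmeet_kernel (hπ : IsOSP Finset.univ π) (M : Fin π.length → ℕ)
    (f : List (Block n) → B) :
    ∑ s ∈ Fintype.piFinset (fun k => Finset.Icc 1 (M (blockFin hπ k))), f (qmeet π (kernel s)) =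
    ∑ σ ∈ (finite_OSPle π).toFinset, (∏ j, (M j).choose (restrict σ π[j]).length) • f σ := by
  classical
  rw [← Finset.sum_fiberwise_of_maps_to (g := fun s => qmeet π (kernel s))
    (t := (finite_OSPle π).toFinset)]
  · refine Finset.sum_congr rfl fun σ hσ => ?_
    rw [Set.Finite.mem_toFinset] at hσ
    have hσr := hσ.1.ranks_blockIdx
    rw [Finset.sum_congr rfl (g := fun _ => f σ) fun s hs => by rw [(Finset.mem_filter.1 hs).2],
      Finset.sum_const]
    congr 1
    have hfilter := Finset.filter_congr (p := fun s => qmeet π (kernel s) = σ)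
      (q := fun s => ∀ k l, blockFin hπ k = blockFin hπ l →
        (s k < s l ↔ blockIdx σ k < blockIdx σ l))
      (s := Fintype.piFinset fun k => Finset.Icc 1 (M (blockFin hπ k))) (fun s _ => by
        rw [qmeet_eq_iff hσ.2 hσr hπ.ranks_blockIdx (ranks_kernel s)]
        simp only [blockFin, Fin.mk.injEq])
    rw [hfilter, card_orderType (blockFin hπ) M (blockIdx σ)]
    refine Finset.prod_congr rfl fun j _ => ?_
    rw [filter_blockFin, length_restrict hσr]
  · intro s _
    rw [Set.Finite.mem_toFinset]
    exact ⟨(hπ.ranks_blockIdx.qmeet (ranks_kernel s)).isOSP, OSPle_qmeet (ranks_kernel s)⟩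

lemma sub_one_mul_add_lt_iff {N s s' i i' : ℕ} (hs : 1 ≤ s) (hs' : 1 ≤ s') (hi : 1 ≤ i)
    (hi' : 1 ≤ i') (hiN : i ≤ N) (hiN' : i' ≤ N) :
    (s - 1) * N + i < (s' - 1) * N + i' ↔ s < s' ∨ s = s' ∧ i < i' := by
  rcases lt_trichotomy s s' with h | rfl | h
  · have := Nat.mul_le_mul_right N (show s - 1 + 1 ≤ s' - 1 by omega)
    rw [add_mul] at this
    omega
  · omega
  · have := Nat.mul_le_mul_right N (show s' - 1 + 1 ≤ s - 1 by omega)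
    rw [add_mul] at this
    omega

/-- Iterated quasi-meets with kernels of tuples in boxes `K` and `N` are quasi-meets with kernels
of tuples in the box `K * N`. -/
lemma sum_sum_qmeet_kernel (hπ : IsOSP Finset.univ π) (K N : Fin π.length → ℕ)
    (f : List (Block n) → B) :
    ∑ s ∈ Fintype.piFinset (fun k => Finset.Icc 1 (K (blockFin hπ k))),
      ∑ i ∈ Fintype.piFinset (fun k => Finset.Icc 1 (N (blockFin hπ k))),
        f (qmeet (qmeet π (kernel s)) (kernel i)) =
    ∑ u ∈ Fintype.piFinset (fun k => Finset.Icc 1 (K (blockFin hπ k) * N (blockFin hπ k))),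
      f (qmeet π (kernel u)) := by
  rw [← Finset.sum_product']
  refine Finset.sum_nbij'
    (fun x k => (x.1 k - 1) * N (blockFin hπ k) + x.2 k)
    (fun u => (fun k => (u k - 1) / N (blockFin hπ k) + 1,
      fun k => (u k - 1) % N (blockFin hπ k) + 1)) ?_ ?_ ?_ ?_ ?_
  · rintro ⟨s, i⟩ hx
    simp only [Finset.mem_product, Fintype.mem_piFinset, Finset.mem_Icc] at hx ⊢
    intro k
    have h₁ := hx.1 k
    have h₂ := hx.2 k
    have := Nat.mul_le_mul_right (N (blockFin hπ k)) (show s k - 1 + 1 ≤ K (blockFin hπ k) by omega)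
    rw [add_mul] at this
    omega
  · intro u hu
    simp only [Finset.mem_product, Fintype.mem_piFinset, Finset.mem_Icc] at hu ⊢
    have hN : ∀ k, 0 < N (blockFin hπ k) := fun k =>
      Nat.pos_of_mul_pos_left (lt_of_lt_of_le Nat.one_pos ((hu k).1.trans (hu k).2))
    refine ⟨fun k => ⟨Nat.le_add_left _ _, ?_⟩, fun k => ⟨Nat.le_add_left _ _, ?_⟩⟩
    · exact (Nat.div_lt_iff_lt_mul (hN k)).2 (by have := hu k; omega)
    · exact Nat.mod_lt _ (hN k)
  · rintro ⟨s, i⟩ hx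
    simp only [Finset.mem_product, Fintype.mem_piFinset, Finset.mem_Icc] at hx
    refine Prod.ext (funext fun k => ?_) (funext fun k => ?_)
    all_goals
      have h₁ := hx.1 k
      have h₂ := hx.2 k
      have h₃ : (s k - 1) * N (blockFin hπ k) + i k - 1 =
          (i k - 1) + N (blockFin hπ k) * (s k - 1) := by
        rw [mul_comm]; omega
      have h₄ : i k - 1 < N (blockFin hπ k) := by omega
      simp only [h₃]
    · rw [Nat.add_mul_div_left _ _ (by omega), Nat.div_eq_of_lt h₄]
      omega
    · rw [Nat.add_mul_mod_self_left, Nat.mod_eq_of_lt h₄]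
      omega
  · intro u hu
    simp only [Fintype.mem_piFinset, Finset.mem_Icc] at hu
    funext k
    have h₁ := Nat.div_add_mod' (u k - 1) (N (blockFin hπ k))
    have h₂ := hu k
    simp only [Nat.add_sub_cancel]
    omega
  · rintro ⟨s, i⟩ hx
    simp only [Finset.mem_product, Fintype.mem_piFinset, Finset.mem_Icc] at hx
    have hb := hπ.ranks_blockIdx
    congr 1
    refine (((hb.qmeet (ranks_kernel s)).qmeet (ranks_kernel i)).congr fun a b => ?_).unique
      (hb.qmeet (ranks_kernel fun k => (s k - 1) * N (blockFin hπ k) + i k))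
    simp only [Prod.Lex.toLex_lt_toLex, EmbeddingLike.apply_eq_iff_eq, Prod.mk.injEq]
    by_cases hab : blockIdx π a = blockIdx π b
    · have hab' : blockFin hπ a = blockFin hπ b := Fin.ext hab
      have h₁ := hx.1 a
      have h₂ := hx.2 a
      rw [hab'] at h₁ h₂ ⊢
      rw [sub_one_mul_add_lt_iff h₁.1 (hx.1 b).1 h₂.1 (hx.2 b).1 h₂.2 (hx.2 b).2]
      simp [hab]
    · simp [hab]

lemma one_le_length_restrict {σ : List (Block n)} (hπ : IsOSP Finset.univ π)
    (hσ : IsOSP Finset.univ σ) (j : Fin π.length) : 1 ≤ (restrict σ π[j]).length := by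
  rw [length_restrict hσ.ranks_blockIdx]
  exact Finset.card_pos.2 ((hπ.1 _ (List.getElem_mem j.2)).image _)

lemma length_restrict_le {σ : List (Block n)} (hσ : IsOSP Finset.univ σ) (P : Block n) :
    (restrict σ P).length ≤ n := by
  rw [length_restrict hσ.ranks_blockIdx]
  exact Finset.card_image_le.trans (by simpa using Finset.card_le_univ P)

/-- The Möbius-type coefficient is multiplicative over the blocks of `π`. -/
lemma muC_eq_prod {σ : List (Block n)} (hπ : IsOSP Finset.univ π) (hσ : IsOSP Finset.univ σ)
    (h : OSPle σ π) :
    muC σ π = ∏ j : Fin π.length,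
      ((-1 : ℂ) ^ ((restrict σ π[j]).length - 1) / ((restrict σ π[j]).length : ℂ)) := by
  have hlen : σ.length = ∑ j : Fin π.length, (restrict σ π[j]).length := by
    conv_lhs => rw [← qmeet_eq_self h hσ hπ]
    rw [qmeet, List.length_flatten, List.map_map]
    exact (Fin.sum_univ_fun_getElem π fun P => (restrict σ P).length).symm
  have hcol : colonNum σ π = ∏ j : Fin π.length, (restrict σ π[j]).length :=
    (Fin.prod_univ_fun_getElem π fun P => (restrict σ P).length).symm
  have hsum : σ.length - π.length = ∑ j : Fin π.length, ((restrict σ π[j]).length - 1) := by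
    have : ∑ j : Fin π.length, ((restrict σ π[j]).length - 1) + ∑ _j : Fin π.length, 1 =
        ∑ j : Fin π.length, (restrict σ π[j]).length := by
      rw [← Finset.sum_add_distrib]
      exact Finset.sum_congr rfl fun j _ => Nat.sub_add_cancel (one_le_length_restrict hπ hσ j)
    rw [Finset.sum_const, Finset.card_univ, Fintype.card_fin, smul_eq_mul, mul_one] at this
    omega
  rw [muC, hsum, hcol, Finset.prod_div_distrib, Finset.prod_pow_eq_pow_sum, Nat.cast_prod]

/-- The extensivity identity for an arbitrary function on ordered set partitions. -/
theorem sum_muC_smul_sum_qmeet_kernel [Module ℂ B] (hπ : IsOSP Finset.univ π) (N : Fin π.length → ℕ)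
    (f : List (Block n) → B) :
    ∑ σ ∈ (finite_OSPle π).toFinset, muC σ π •
      ∑ i ∈ Fintype.piFinset (fun k => Finset.Icc 1 (N (blockFin hπ k))), f (qmeet σ (kernel i)) =
    (∏ j, N j) • ∑ σ ∈ (finite_OSPle π).toFinset, muC σ π • f σ := by
  obtain ⟨w, hw⟩ := exists_weights_choose n
  let R : Finset (Fin π.length → ℕ) := Fintype.piFinset fun _ => Finset.range (n + 1)
  have key : ∀ (L : Fin π.length → ℕ), ∀ σ ∈ (finite_OSPle π).toFinset,
      ((∏ j, L j : ℕ) : ℂ) * muC σ π = ∑ K ∈ R, (∏ j, w (K j)) *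
        ((∏ j, (K j * L j).choose (restrict σ π[j]).length : ℕ) : ℂ) := by
    intro L σ hσ
    rw [Set.Finite.mem_toFinset] at hσ
    rw [muC_eq_prod hπ hσ.1 hσ.2, Nat.cast_prod, ← Finset.prod_mul_distrib]
    have : ∀ j : Fin π.length, (L j : ℂ) *
        ((-1 : ℂ) ^ ((restrict σ π[j]).length - 1) / ((restrict σ π[j]).length : ℂ)) =
        ∑ k ∈ Finset.range (n + 1), w k * ((k * L j).choose (restrict σ π[j]).length : ℂ) :=
      fun j => (hw _ _ (one_le_length_restrict hπ hσ.1 j) (length_restrict_le hσ.1 _)).symm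
    rw [Finset.prod_congr rfl fun j _ => this j, Finset.prod_univ_sum]
    refine Finset.sum_congr rfl fun K _ => ?_
    rw [Finset.prod_mul_distrib, Nat.cast_prod]
  have key' : ∀ (L : Fin π.length → ℕ) (g : List (Block n) → B),
      (∏ j, L j) • ∑ σ ∈ (finite_OSPle π).toFinset, muC σ π • g σ =
      ∑ K ∈ R, (∏ j, w (K j)) •
        ∑ s ∈ Fintype.piFinset (fun k =>
          Finset.Icc 1 (K (blockFin hπ k) * L (blockFin hπ k))), g (qmeet π (kernel s)) := by
    intro L g
    simp_rw [sum_qmeet_kernel hπ (fun j => _ * L j) g]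
    rw [← Nat.cast_smul_eq_nsmul ℂ, Finset.smul_sum]
    simp_rw [Finset.smul_sum]
    rw [Finset.sum_comm]
    refine Finset.sum_congr rfl fun σ hσ => ?_
    rw [smul_smul, key L σ hσ, Finset.sum_smul]
    refine Finset.sum_congr rfl fun K _ => ?_
    rw [mul_smul, Nat.cast_smul_eq_nsmul]
  have h := key' (fun _ => 1) fun σ =>
    ∑ i ∈ Fintype.piFinset (fun k => Finset.Icc 1 (N (blockFin hπ k))), f (qmeet σ (kernel i))
  simp only [Finset.prod_const_one, one_smul, mul_one] at h
  rw [h, key' N f]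
  exact Finset.sum_congr rfl fun K _ => by rw [sum_sum_qmeet_kernel hπ K N f]

end Extensivity

end

/-- Under the spreadability assumptions, cumulants are extensive:
for all `π = (P₁,…,P_p) ∈ OP_n`, `X₁,…,Xₙ ∈ A` and `N₁,…,N_p ∈ ℕ`,
`∑_{σ ≤ π} μ̃(σ,π)·(∑_{i_k ∈ [N_{π(k)}]} φ_{σ⋏κ(i)}(X)) = N₁⋯N_p · ∑_{σ ≤ π} μ̃(σ,π) φ_σ(X)`,
i.e. `K_π(N_{π(1)}.X₁,…,N_{π(n)}.Xₙ) = N₁⋯N_p · K_π(X₁,…,Xₙ)`. In particular, taking all `N_j`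
equal to `N₀`, `K_π(N₀.X₁,…,N₀.Xₙ) = N₀^{|π|} K_π(X₁,…,Xₙ)`. -/
theorem statement11 {A U B : Type*} [Ring A] [Algebra ℂ A] [Ring U] [Algebra ℂ U]
    [AddCommGroup B] [Module ℂ B] (φ : U →ₗ[ℂ] B) (ι : ℕ → (A →ₙₐ[ℂ] U))
    (hspread : ∀ (m : ℕ) (X : Fin m → A) (i : Fin m → ℕ) (h : ℕ → ℕ),
      (∀ p q : Fin m, i p < i q → h (i p) < h (i q)) →
      φ ((List.ofFn (fun k => ι (i k) (X k))).prod)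
        = φ ((List.ofFn (fun k => ι (h (i k)) (X k))).prod))
    {n : ℕ} (hn : 1 ≤ n) (π : List (Block n)) (hπ : IsOSP Finset.univ π)
    (X : Fin n → A) :
    (∀ N : ℕ → ℕ,
      (∑ᶠ σ ∈ {σ : List (Block n) | IsOSP Finset.univ σ ∧ OSPle σ π},
        muC σ π • (∑ᶠ i ∈ {i : Fin n → ℕ | ∀ k : Fin n, i k ∈ Finset.Icc 1 (N (blockIdx π k))},
          phiPart φ ι (qmeet σ (kernel i)) X))
      = (∏ j ∈ Finset.range π.length, N j) •
          ∑ᶠ σ ∈ {σ : List (Block n) | IsOSP Finset.univ σ ∧ OSPle σ π},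
            muC σ π • phiPart φ ι σ X) ∧
    (∀ N₀ : ℕ,
      (∑ᶠ σ ∈ {σ : List (Block n) | IsOSP Finset.univ σ ∧ OSPle σ π},
        muC σ π • (∑ᶠ i ∈ {i : Fin n → ℕ | ∀ k : Fin n, i k ∈ Finset.Icc 1 N₀},
          phiPart φ ι (qmeet σ (kernel i)) X))
      = (N₀ ^ π.length) •
          ∑ᶠ σ ∈ {σ : List (Block n) | IsOSP Finset.univ σ ∧ OSPle σ π},
            muC σ π • phiPart φ ι σ X) := by
  have main : ∀ N : ℕ → ℕ,
      (∑ᶠ σ ∈ {σ : List (Block n) | IsOSP Finset.univ σ ∧ OSPle σ π},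
        muC σ π • (∑ᶠ i ∈ {i : Fin n → ℕ | ∀ k : Fin n, i k ∈ Finset.Icc 1 (N (blockIdx π k))},
          phiPart φ ι (qmeet σ (kernel i)) X))
      = (∏ j ∈ Finset.range π.length, N j) •
          ∑ᶠ σ ∈ {σ : List (Block n) | IsOSP Finset.univ σ ∧ OSPle σ π},
            muC σ π • phiPart φ ι σ X := by
    intro N
    have hbox : {i : Fin n → ℕ | ∀ k : Fin n, i k ∈ Finset.Icc 1 (N (blockIdx π k))} =
        ((Fintype.piFinset fun k => Finset.Icc 1 (N (blockFin hπ k)) : Finset (Fin n → ℕ)) :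
          Set (Fin n → ℕ)) := by
      ext i
      simp only [Set.mem_ofPred_eq, Finset.mem_coe, Fintype.mem_piFinset, blockFin]
    rw [finsum_mem_eq_finite_toFinset_sum _ (finite_OSPle π),
      finsum_mem_eq_finite_toFinset_sum _ (finite_OSPle π), Finset.prod_range]
    simp_rw [hbox, finsum_mem_coe_finset]
    exact sum_muC_smul_sum_qmeet_kernel hπ (fun j => N j) fun σ => phiPart φ ι σ X
  exact ⟨main, fun N₀ => by simpa using main fun _ => N₀⟩

end OSPpaper
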